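/- Let S be a projective K3 surface, X = Hilb_n(S), and let W ⊂ A^*(X × X) be the image of act : U(g_NS) → A^*(X × X), a finite-dimensional representation of the semisimple Lie algebra g_NS with isotypic decomposition W = ⊕_ψ W_ψ over the irreducible representations ψ of g_NS. Write Δ_X = Σ_ψ P_ψ with P_ψ ∈ W_ψ. Then the elements P_ψ ∈ A^*(X × X) are mutually orthogonal projectors: P_ψ ∘ P_{ψ'} = δ_{ψψ'} P_ψ. -/

import Mathlib

/-!
# Statement 14 (Claim 3.2 of Neguț–Oberdieck–Yin)

Let `S` be a projective K3 surface and `X = Hilb_n(S)`.  We model: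

* `C2` = the ℚ-algebra of self-correspondences `A^*(X × X)` (multiplication =
  composition, unit = diagonal `Δ_X`);
* `U` = the universal enveloping algebra `U(g_NS)` of the Néron–Severi part of the
  (semisimple) LLV Lie algebra, `actU : U(g_NS) → A^*(X × X)` the algebra homomorphism
  extending the LLV action; `W = actU.range` is its image, a finite-dimensional
  `g_NS`-subrepresentation of `A^*(X × X)` (for the action by post-composition),
  closed under composition of correspondences;
* `Wc ψ` = the isotypic components of `W`, indexed by the (pairwise non-isomorphic,
  simple) representations `rep ψ` occurring in `W`: they are `g_NS`-stable, form an
  internal direct sum decomposition of `W`, and `Wc ψ` is a direct sum of copies of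
  `rep ψ` (hypothesis `hiso`, the isomorphism being `U(g_NS)`-equivariant);
* `P ψ ∈ Wc ψ` = the components of the diagonal: `Δ_X = Σ_ψ P ψ`.
-/

/-- Isotypic components of pairwise non-isomorphic simple types are independent. -/
theorem iSupIndep_isotypicComponent {R M ι : Type*} {S : ι → Type*} [Ring R] [AddCommGroup M]
    [Module R M] [∀ i, AddCommGroup (S i)] [∀ i, Module R (S i)] [∀ i, IsSimpleModule R (S i)]
    (hS : ∀ i j, i ≠ j → IsEmpty (S i ≃ₗ[R] S j)) :
    iSupIndep fun i ↦ isotypicComponent R M (S i) := by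
  intro i
  set c := fun j ↦ isotypicComponent R M (S j)
  change Disjoint (c i) (⨆ j ∈ {j | j ≠ i}, c j)
  rw [disjoint_iff, ← sSup_image]
  by_contra ne
  have := IsSemisimpleModule.of_injective _
    (Submodule.inclusion_injective (inf_le_left : c i ⊓ sSup (c '' {j | j ≠ i}) ≤ c i))
  have (m : c '' {j | j ≠ i}) : IsSemisimpleModule R m := by
    obtain ⟨_, j, _, rfl⟩ := m
    exact inferInstanceAs (IsSemisimpleModule R (isotypicComponent R M (S j)))
  obtain ⟨N, le, _⟩ := (IsSemisimpleModule.eq_bot_or_exists_simple_le _).resolve_left ne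
  obtain ⟨_, ⟨j, hj, rfl⟩, N', le', ⟨e⟩⟩ := N.le_linearEquiv_of_le_sSup _ (le.trans inf_le_right)
  have := IsSimpleModule.congr e.symm
  obtain ⟨ei⟩ := isIsotypicOfType_submodule_iff.mp (.isotypicComponent R M (S i)) N
    (le.trans inf_le_left)
  obtain ⟨ej⟩ := isIsotypicOfType_submodule_iff.mp (.isotypicComponent R M (S j)) N' le'
  exact (hS j i hj).false (ej.symm.trans (e.symm.trans ei))

/-- A module that is a direct sum of copies of `S` maps into the `S`-isotypic component. -/
theorem LinearMap.mem_isotypicComponent_of_finsupp {R M S ι : Type*} [Ring R] [AddCommGroup M]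
    [Module R M] [AddCommGroup S] [Module R S] [IsSimpleModule R S]
    (f : (ι →₀ S) →ₗ[R] M) (m : ι →₀ S) : f m ∈ isotypicComponent R M S := by
  induction m using Finsupp.induction_linear with
  | zero => simp
  | add m n hm hn => simpa using add_mem hm hn
  | single i s =>
    obtain inj | eq := (f ∘ₗ Finsupp.lsingle i).injective_or_eq_zero
    · have : LinearMap.range (f ∘ₗ Finsupp.lsingle i) ≤ isotypicComponent R M S :=
        le_sSup ⟨.symm <| .ofInjective _ inj⟩
      exact this ⟨s, rfl⟩
    · rw [show f (Finsupp.single i s) = 0 from LinearMap.congr_fun eq s]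
      exact zero_mem _

open scoped Classical in
/-- Claim 3.2 of the paper. Writing `Δ_X = Σ_ψ P_ψ` with
`P_ψ ∈ W_ψ` for the isotypic decomposition `W = ⊕_ψ W_ψ` of the image `W` of
`U(g_NS)` in `A^*(X × X)`, the elements `P_ψ` are mutually orthogonal projectors:
`P_ψ ∘ P_ψ' = δ_{ψψ'} P_ψ`. -/
theorem statement14
    (C2 : Type) [Ring C2] [Algebra ℚ C2]
    (U : Type) [Ring U] [Algebra ℚ U]
    (actU : U →ₐ[ℚ] C2)
    (Ψ : Type) (rep : Ψ → Type)
    [∀ ψ, AddCommGroup (rep ψ)] [∀ ψ, Module ℚ (rep ψ)] [∀ ψ, Module U (rep ψ)]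
    (hsimple : ∀ ψ, IsSimpleModule U (rep ψ))
    (hdistinct : ∀ ψ ψ', ψ ≠ ψ' → IsEmpty (rep ψ ≃ₗ[U] rep ψ'))
    -- the isotypic decomposition W = ⊕_ψ W_ψ of W = im(U(g_NS)) ⊂ A^*(X × X)
    (Wc : Ψ → Submodule ℚ C2)
    (hle : ∀ ψ, Wc ψ ≤ Subalgebra.toSubmodule actU.range)
    (hstable : ∀ (ψ : Ψ) (u : U) (x : C2), x ∈ Wc ψ → actU u * x ∈ Wc ψ)
    (hindep : iSupIndep Wc)
    (hspan : (⨆ ψ, Wc ψ) = Subalgebra.toSubmodule actU.range)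
    (hiso : ∀ ψ, ∃ (ι : Type) (e : (ι →₀ rep ψ) ≃ₗ[ℚ] Wc ψ),
      ∀ (u : U) (m : ι →₀ rep ψ), (↑(e (u • m)) : C2) = actU u * (↑(e m) : C2))
    -- the decomposition Δ_X = Σ_ψ P_ψ of the diagonal, with P_ψ ∈ W_ψ
    (P : Ψ → C2) (hP : ∀ ψ, P ψ ∈ Wc ψ)
    (hfin : Set.Finite {ψ | P ψ ≠ 0})
    (hsum : (∑ᶠ ψ, P ψ) = 1) :
    ∀ ψ ψ', P ψ * P ψ' = if ψ = ψ' then P ψ else 0 := by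
  classical
  intro ψ ψ'
  let _ : Module U C2 := Module.compHom C2 actU.toRingHom
  set I := fun φ ↦ isotypicComponent U C2 (rep φ)
  have hPI (φ : Ψ) : P φ ∈ I φ := by
    obtain ⟨ι, e, he⟩ := hiso φ
    let f : (ι →₀ rep φ) →ₗ[U] C2 :=
      { toFun m := e m
        map_add' := by simp
        map_smul' := he }
    have := f.mem_isotypicComponent_of_finsupp (e.symm ⟨P φ, hP φ⟩)
    simpa [f] using this
  let r : C2 →ₗ[U] C2 :=
    { toFun x := x * P ψ'
      map_add' := fun x y ↦ add_mul x y _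
      map_smul' := fun u x ↦ mul_assoc (actU u) x _ }
  have hr (φ : Ψ) : P φ * P ψ' ∈ I φ := r.le_comap_isotypicComponent (rep φ) (hPI φ)
  have hind : iSupIndep I := iSupIndep_isotypicComponent hdistinct
  set s : Finset Ψ := insert ψ (insert ψ' hfin.toFinset)
  have hs : ∑ φ ∈ s, P φ = 1 := by
    rw [← hsum]
    exact (finsum_eq_sum_of_support_subset _ fun φ hφ ↦ by
      simp [s, show P φ ≠ 0 from hφ]).symm
  have hs' : ∑ φ ∈ s, P φ * P ψ' = ∑ φ ∈ s, if φ = ψ' then P φ else 0 := by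
    rw [← Finset.sum_mul, hs, one_mul, Finset.sum_ite_eq' s ψ' P, if_pos (by simp [s])]
  refine (iSupIndep_iff_finsetSum_eq_imp_eq I).mp hind s _ _
    (fun φ _ ↦ ⟨hr φ, ?_⟩) hs' ψ (by simp [s])
  split_ifs
  exacts [hPI φ, zero_mem _]
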